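/- Let I be a translation invariant ideal of subsets of ℕ and let a be a base sequence adapted to I. Then H = { r ∈ ℝ : j_a(|r|) ∈ I } is an additive subgroup of ℝ, and H is closed under multiplication by every element of ℚ_a; that is, H is a ℚ_a-submodule of ℝ. -/

import Mathlib

open Set Filter
open scoped ENNReal

/-- `a₀ a₁ ⋯ a_{n-1}` as a real number: the product of the first `n` terms of the
base sequence (the paper's `a₁ ⋯ a_n`, re-indexed from 0). -/
noncomputable def bProd (a : ℕ → ℕ) (n : ℕ) : ℝ := ∏ k ∈ Finset.range n, (a k : ℝ)

/-- The `n`-th digit (0-indexed; the paper's `(n+1)`-st digit) of the nonnegative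
real `r` in base `a`:  `r_n = ⌊a₁⋯a_n (r - ⌊r⌋)⌋ - a_n ⌊a₁⋯a_{n-1} (r - ⌊r⌋)⌋`. -/
noncomputable def digit (a : ℕ → ℕ) (r : ℝ) (n : ℕ) : ℤ :=
  ⌊bProd a (n + 1) * Int.fract r⌋ - (a n : ℤ) * ⌊bProd a n * Int.fract r⌋

/-- `j_a(r) = { n : r_n ≠ r_{n+1} }`. -/
def jSet (a : ℕ → ℕ) (r : ℝ) : Set ℕ := {n | digit a r n ≠ digit a r (n + 1)}

/-- An ideal of subsets of ℕ: closed under subsets and finite unions, containing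
all singletons (hence nonempty). -/
def IsIdeal (I : Set (Set ℕ)) : Prop :=
  (∀ ⦃x y : Set ℕ⦄, x ∈ I → y ⊆ x → y ∈ I) ∧
  (∀ ⦃x y : Set ℕ⦄, x ∈ I → y ∈ I → x ∪ y ∈ I) ∧
  (∀ n : ℕ, ({n} : Set ℕ) ∈ I)

/-- Translation invariance of a family of subsets of ℕ. -/
def TransInv (I : Set (Set ℕ)) : Prop :=
  ∀ x ∈ I, ({n | ∃ m ∈ x, n = m + 1} ∈ I) ∧ ({n | n + 1 ∈ x} ∈ I)

/-- A tall family: every infinite set of naturals has an infinite subset in the family. -/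
def TallIdeal (I : Set (Set ℕ)) : Prop :=
  ∀ x : Set ℕ, x.Infinite → ∃ y, y ⊆ x ∧ y.Infinite ∧ y ∈ I

/-- The base sequence `a` is adapted to `I` if `{n : a_n ≠ a_{n+1}} ∈ I`. -/
def AdaptedTo (a : ℕ → ℕ) (I : Set (Set ℕ)) : Prop := {n | a n ≠ a (n + 1)} ∈ I

/-- A lower semicontinuous submeasure on subsets of ℕ. -/
def IsLscSubmeasure (φ : Set ℕ → ℝ≥0∞) : Prop :=
  φ ∅ = 0 ∧
  (∀ ⦃x y : Set ℕ⦄, x ⊆ y → φ x ≤ φ y) ∧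
  (∀ x y : Set ℕ, φ (x ∪ y) ≤ φ x + φ y) ∧
  (∀ n : ℕ, 0 < φ {n} ∧ φ {n} < ⊤) ∧
  (∀ x : Set ℕ, φ x = ⨆ n : ℕ, φ (x ∩ {k | k < n}))

/-- `Exh(φ) = { x ⊆ ℕ : φ(x \ {0,…,n-1}) → 0 }`. -/
def Exh (φ : Set ℕ → ℝ≥0∞) : Set (Set ℕ) :=
  {x | Filter.Tendsto (fun n => φ (x \ {k | k < n})) Filter.atTop (nhds 0)}

/-- `pr(a)`: the set of primes dividing `a_n` for all but finitely many `n`. -/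
def prSet (a : ℕ → ℕ) : Set ℕ := {p | p.Prime ∧ ∀ᶠ n in Filter.atTop, p ∣ a n}

/-- A base sequence is uniform if every prime dividing some `a_n` divides `a_n`
for all but finitely many `n`. -/
def UniformBase (a : ℕ → ℕ) : Prop :=
  ∀ p : ℕ, p.Prime → (∃ n, p ∣ a n) → ∀ᶠ n in Filter.atTop, p ∣ a n

/-- `ℚ_a`, viewed as a set of real numbers: fractions `k/l` with every prime
divisor of `l` in `pr(a)`. -/
def Qa (a : ℕ → ℕ) : Set ℝ :=
  {r | ∃ (k : ℤ) (l : ℕ), 0 < l ∧ (∀ p : ℕ, p.Prime → p ∣ l → p ∈ prSet a) ∧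
    r = (k : ℝ) / (l : ℝ)}

/-- `H = { r ∈ ℝ : j_a(|r|) ∈ I }`. -/
def Hset (a : ℕ → ℕ) (I : Set (Set ℕ)) : Set ℝ := {r | jSet a |r| ∈ I}

/-- `ρ(r,s) = φ(j_a(|r-s|)) + |r-s|`. -/
noncomputable def rho (a : ℕ → ℕ) (φ : Set ℕ → ℝ≥0∞) (r s : ℝ) : ℝ :=
  (φ (jSet a |r - s|)).toReal + |r - s|

/-- The filter dual to an ideal of subsets of `ℕ`. -/
def IsIdeal.dualFilter {I : Set (Set ℕ)} (hI : IsIdeal I) : Filter ℕ where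
  sets := {s | sᶜ ∈ I}
  univ_sets := hI.1 (hI.2.2 0) (by simp)
  sets_of_superset hx hxy := hI.1 hx (compl_subset_compl.2 hxy)
  inter_sets hx hy := by
    rw [Set.mem_ofPred_eq, compl_inter]
    exact hI.2.1 hx hy

namespace IsIdeal

variable {I : Set (Set ℕ)} (hI : IsIdeal I)

theorem eventually_dualFilter {P : ℕ → Prop} :
    (∀ᶠ n in hI.dualFilter, P n) ↔ {n | ¬ P n} ∈ I := Iff.rfl

theorem dualFilter_le_atTop : hI.dualFilter ≤ atTop := by
  rw [← Nat.cofinite_eq_atTop, le_cofinite_iff_eventually_ne]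
  intro n
  simpa [eventually_dualFilter] using hI.2.2 n

theorem eventually_succ (htr : TransInv I) {P : ℕ → Prop}
    (h : ∀ᶠ n in hI.dualFilter, P n) : ∀ᶠ n in hI.dualFilter, P (n + 1) :=
  (htr _ h).2

theorem eventually_of_succ (htr : TransInv I) {P : ℕ → Prop}
    (h : ∀ᶠ n in hI.dualFilter, P (n + 1)) : ∀ᶠ n in hI.dualFilter, P n := by
  have hshift : ∀ᶠ n in hI.dualFilter, ¬ ∃ m, ¬ P (m + 1) ∧ n = m + 1 := by
    simp only [eventually_dualFilter, not_not]
    exact (htr _ h).1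
  filter_upwards [hshift, hI.dualFilter_le_atTop (eventually_ge_atTop 1)] with n hn h1
  by_contra hP
  obtain ⟨m, rfl⟩ := Nat.exists_eq_add_of_le' h1
  exact hn ⟨m, hP, rfl⟩

end IsIdeal

theorem bProd_succ (a : ℕ → ℕ) (n : ℕ) : bProd a (n + 1) = bProd a n * a n :=
  Finset.prod_range_succ _ _

theorem fract_bProd_mul_fract (a : ℕ → ℕ) (n : ℕ) (r : ℝ) :
    Int.fract (bProd a n * Int.fract r) = Int.fract (bProd a n * r) := by
  rw [Int.fract_eq_fract]
  refine ⟨-((∏ k ∈ Finset.range n, a k : ℕ) * ⌊r⌋), ?_⟩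
  simp only [bProd, Int.fract]
  push_cast
  ring

/-- The digit recursion: multiplying the `n`-th fractional part by `a n` produces the `n`-th digit
and the next fractional part. -/
theorem mul_fract_bProd_mul (a : ℕ → ℕ) (r : ℝ) (n : ℕ) :
    a n * Int.fract (bProd a n * r) = digit a r n + Int.fract (bProd a (n + 1) * r) := by
  rw [← fract_bProd_mul_fract a n r, ← fract_bProd_mul_fract a (n + 1) r]
  simp only [digit, Int.fract, bProd_succ]
  push_cast
  ring

theorem digit_eq_floor (a : ℕ → ℕ) (r : ℝ) (n : ℕ) :
    digit a r n = ⌊a n * Int.fract (bProd a n * r)⌋ := by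
  rw [mul_fract_bProd_mul, Int.floor_intCast_add, Int.floor_fract, add_zero]

theorem digit_nonneg (a : ℕ → ℕ) (r : ℝ) (n : ℕ) : 0 ≤ digit a r n := by
  rw [digit_eq_floor]
  positivity

theorem digit_lt {a : ℕ → ℕ} {n : ℕ} (ha : 0 < a n) (r : ℝ) : digit a r n < a n := by
  rw [digit_eq_floor, Int.floor_lt]
  have : (0 : ℝ) < a n := by exact_mod_cast ha
  push_cast
  nlinarith [Int.fract_lt_one (bProd a n * r)]

/-- The digits of a difference, in terms of borrows `c n ∈ {-1, 0}`. -/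
theorem exists_borrow (a : ℕ → ℕ) (r s : ℝ) :
    ∃ c : ℕ → ℤ, (∀ n, c n = -1 ∨ c n = 0) ∧
      ∀ n, digit a (r - s) n = digit a r n - digit a s n + c (n + 1) - a n * c n := by
  have h (n : ℕ) : ∃ c : ℤ, Int.fract (bProd a n * r) - Int.fract (bProd a n * s) -
      Int.fract (bProd a n * (r - s)) = c := by
    refine ⟨⌊bProd a n * (r - s)⌋ - ⌊bProd a n * r⌋ + ⌊bProd a n * s⌋, ?_⟩
    simp only [Int.fract]
    push_cast
    ring
  choose c hc using h
  refine ⟨c, fun n => ?_, fun n => ?_⟩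
  · have h₁ : (c n : ℝ) < 1 := by
      rw [← hc]
      linarith [Int.fract_lt_one (bProd a n * r), Int.fract_nonneg (bProd a n * s),
        Int.fract_nonneg (bProd a n * (r - s))]
    have h₂ : (-2 : ℝ) < c n := by
      rw [← hc]
      linarith [Int.fract_nonneg (bProd a n * r), Int.fract_lt_one (bProd a n * s),
        Int.fract_lt_one (bProd a n * (r - s))]
    have h₃ : c n < 1 := by exact_mod_cast h₁
    have h₄ : -2 < c n := by exact_mod_cast h₂
    omega
  · have : (digit a (r - s) n : ℝ) = digit a r n - digit a s n + c (n + 1) - a n * c n := by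
      rw [← hc, ← hc]
      linarith [mul_fract_bProd_mul a r n, mul_fract_bProd_mul a s n,
        mul_fract_bProd_mul a (r - s) n]
    exact_mod_cast this

/-- If the digits of `r` and `s` and the bases agree at `n`, `n + 1`, `n + 2`, then so do
the digits of `r - s` at `n` and `n + 1`. -/
theorem digit_sub_eq_succ {a : ℕ → ℕ} (ha : ∀ n, 0 < a n) {r s : ℝ} {n : ℕ}
    (ha₀ : a n = a (n + 1)) (ha₁ : a (n + 1) = a (n + 2))
    (hr₀ : digit a r n = digit a r (n + 1)) (hr₁ : digit a r (n + 1) = digit a r (n + 2))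
    (hs₀ : digit a s n = digit a s (n + 1)) (hs₁ : digit a s (n + 1) = digit a s (n + 2)) :
    digit a (r - s) n = digit a (r - s) (n + 1) := by
  obtain ⟨c, hc, hd⟩ := exists_borrow a r s
  have hd₀ := hd n
  have hd₁ := hd (n + 1)
  have hd₂ := hd (n + 2)
  have hn := digit_nonneg a (r - s)
  have hl := fun k => digit_lt (ha k) (r - s)
  have hn₀ := hn n
  have hn₁ := hn (n + 1)
  have hn₂ := hn (n + 2)
  have hl₀ := hl n
  have hl₁ := hl (n + 1)
  have hl₂ := hl (n + 2)
  rcases hc n with h₀ | h₀ <;> rcases hc (n + 1) with h₁ | h₁ <;>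
    rcases hc (n + 2) with h₂ | h₂ <;> rcases hc (n + 3) with h₃ | h₃ <;>
    simp only [h₀, h₁, h₂, h₃, add_assoc, Nat.reduceAdd] at hd₀ hd₁ hd₂ <;> omega

/-- The digits of `r / p` at places where `p` divides the base. -/
theorem digit_div {a : ℕ → ℕ} {p : ℕ} (hp : 0 < p) {n : ℕ} (r : ℝ)
    (h₀ : p ∣ a n) (h₁ : p ∣ a (n + 1)) :
    digit a (r / p) (n + 1) =
      (a (n + 1) / p : ℕ) * (digit a r n % p) + digit a r (n + 1) / p := by
  obtain ⟨b, hb⟩ := h₀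
  obtain ⟨b', hb'⟩ := h₁
  have hp' : (0 : ℝ) < p := by exact_mod_cast hp
  have hmod : ((digit a r n : ℤ) : ℝ) = p * (digit a r n / p : ℤ) + (digit a r n % p : ℤ) := by
    exact_mod_cast (Int.mul_ediv_add_emod (digit a r n) p).symm
  have hfract : Int.fract (bProd a (n + 1) * (r / p)) =
      ((digit a r n % p : ℤ) + Int.fract (bProd a (n + 1) * r)) / p := by
    rw [Int.fract_eq_iff]
    have hlt : ((digit a r n % p : ℤ) : ℝ) + 1 ≤ p := by
      exact_mod_cast Int.emod_lt_of_pos (digit a r n) (by exact_mod_cast hp)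
    have hnn : (0 : ℝ) ≤ (digit a r n % p : ℤ) := by
      exact_mod_cast Int.emod_nonneg (digit a r n) (by exact_mod_cast hp.ne')
    have hfn := Int.fract_nonneg (bProd a (n + 1) * r)
    have hfl := Int.fract_lt_one (bProd a (n + 1) * r)
    refine ⟨by positivity, by rw [div_lt_one hp']; linarith,
      b * ⌊bProd a n * r⌋ + digit a r n / p, ?_⟩
    have hrec := mul_fract_bProd_mul a r n
    have hfl' : (⌊bProd a n * r⌋ : ℝ) = bProd a n * r - Int.fract (bProd a n * r) := by
      rw [Int.fract, sub_sub_cancel]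
    have hsucc : bProd a (n + 1) = bProd a n * (p * b) := by
      rw [bProd_succ, hb]
      push_cast
      ring
    rw [hb, hmod] at hrec
    push_cast at hrec ⊢
    rw [hfl', ← mul_div_assoc, ← sub_div, div_eq_iff hp'.ne']
    rw [hsucc] at hrec ⊢
    generalize Int.fract (bProd a n * r) = x at hrec ⊢
    generalize Int.fract (bProd a n * (p * b) * r) = y at hrec ⊢
    linarith
  have hrec := mul_fract_bProd_mul a r (n + 1)
  rw [digit_eq_floor a (r / p), hfract, hb', Nat.mul_div_cancel_left _ hp]
  have hfloor : digit a r (n + 1) / (p : ℤ) =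
      ⌊(digit a r (n + 1) + Int.fract (bProd a (n + 2) * r)) / p⌋ := by
    rw [Int.floor_div_natCast, Int.floor_intCast_add, Int.floor_fract, add_zero]
  rw [hfloor, ← Int.floor_intCast_add, ← hrec, hb']
  congr 1
  push_cast
  field_simp

theorem jSet_sub_mem {a : ℕ → ℕ} (ha : ∀ n, 0 < a n) {I : Set (Set ℕ)} (hI : IsIdeal I)
    (htr : TransInv I) (had : AdaptedTo a I) {r s : ℝ} (hr : jSet a r ∈ I) (hs : jSet a s ∈ I) :
    jSet a (r - s) ∈ I := by
  have had' := hI.eventually_dualFilter.2 had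
  have hr' := hI.eventually_dualFilter.2 hr
  have hs' := hI.eventually_dualFilter.2 hs
  refine hI.eventually_dualFilter.1 ?_
  filter_upwards [had', hI.eventually_succ htr had', hr', hI.eventually_succ htr hr', hs',
    hI.eventually_succ htr hs'] with n h₁ h₂ h₃ h₄ h₅ h₆
  exact digit_sub_eq_succ ha h₁ h₂ h₃ h₄ h₅ h₆

/-- The additive subgroup of reals whose set of digit changes lies in `I`. -/
def jSubgroup (a : ℕ → ℕ) (ha : ∀ n, 0 < a n) (I : Set (Set ℕ)) (hI : IsIdeal I)
    (htr : TransInv I) (had : AdaptedTo a I) : AddSubgroup ℝ :=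
  AddSubgroup.ofSub {r | jSet a r ∈ I}
    ⟨0, hI.1 (hI.2.2 0) (by simp [jSet, digit])⟩
    fun _ hr _ hs => jSet_sub_mem ha hI htr had hr hs

theorem jSet_div_mem {a : ℕ → ℕ} {I : Set (Set ℕ)} (hI : IsIdeal I)
    (htr : TransInv I) (had : AdaptedTo a I) {p : ℕ} (hp : 0 < p)
    (hpa : ∀ᶠ n in atTop, p ∣ a n) {r : ℝ} (hr : jSet a r ∈ I) : jSet a (r / p) ∈ I := by
  have had' := hI.eventually_dualFilter.2 had
  have hr' := hI.eventually_dualFilter.2 hr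
  have hpa' := hI.dualFilter_le_atTop hpa
  refine hI.eventually_dualFilter.1 (hI.eventually_of_succ htr ?_)
  filter_upwards [hI.eventually_succ htr had', hr', hI.eventually_succ htr hr', hpa',
    hI.eventually_succ htr hpa', hI.eventually_succ htr (hI.eventually_succ htr hpa')]
    with n h₁ h₂ h₃ h₄ h₅ h₆
  rw [digit_div hp r h₄ h₅, digit_div hp r h₅ h₆, ← h₁, ← h₃, ← h₂]

theorem jSet_div_mem_of_primes {a : ℕ → ℕ} {I : Set (Set ℕ)} (hI : IsIdeal I)
    (htr : TransInv I) (had : AdaptedTo a I) {l : ℕ} (hl : 0 < l)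
    (hla : ∀ p : ℕ, p.Prime → p ∣ l → p ∈ prSet a) {r : ℝ} (hr : jSet a r ∈ I) :
    jSet a (r / l) ∈ I := by
  induction l using induction_on_primes generalizing r with
  | zero => omega
  | one => simpa using hr
  | prime_mul p m hp ih =>
    rw [Nat.cast_mul, ← div_div]
    exact ih (Nat.pos_of_mul_pos_left hl) (fun q hq hqm => hla q hq (hqm.mul_left p))
      (jSet_div_mem hI htr had hp.pos (hla p hp (dvd_mul_right p m)).2 hr)

/-- Lemma 2.9: `H` is a `ℚ_a`-submodule of ℝ. -/
theorem Hset_submodule (a : ℕ → ℕ) (ha : ∀ n, 2 ≤ a n)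
    (I : Set (Set ℕ)) (hI : IsIdeal I) (htr : TransInv I) (had : AdaptedTo a I) :
    (0 : ℝ) ∈ Hset a I ∧
    (∀ r ∈ Hset a I, ∀ s ∈ Hset a I, r + s ∈ Hset a I) ∧
    (∀ r ∈ Hset a I, -r ∈ Hset a I) ∧
    (∀ q ∈ Qa a, ∀ r ∈ Hset a I, q * r ∈ Hset a I) := by
  have ha' (n : ℕ) : 0 < a n := by linarith [ha n]
  have hmem (r : ℝ) : r ∈ Hset a I ↔ r ∈ jSubgroup a ha' I hI htr had := by
    rw [← abs_mem_iff]
    rfl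
  simp only [hmem]
  refine ⟨zero_mem _, fun r hr s hs => add_mem hr hs, fun r hr => neg_mem hr, ?_⟩
  rintro q ⟨k, l, hl, hla, rfl⟩ r hr
  have hdiv : r / l ∈ jSubgroup a ha' I hI htr had :=
    jSet_div_mem_of_primes hI htr had hl hla hr
  simpa only [zsmul_eq_mul, mul_div_assoc', div_mul_eq_mul_div] using zsmul_mem hdiv k
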